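/- Let x ≥ 6 and k ≥ 4 be integers, with k of the form p(p−1)/2 + 1 for some positive integer p. Then there are infinitely many perfect squares not divisible by x having exactly k non-zero digits in their base-x representation. -/

import Mathlib

/-- The number of non-zero digits of `n` in base `x`. -/
def nonzeroDigitCount (x n : ℕ) : ℕ := ((Nat.digits x n).filter (· ≠ 0)).length

lemma nonzeroDigitCount_of_lt {x n : ℕ} (hn : 0 < n) (hnx : n < x) :
    nonzeroDigitCount x n = 1 := by
  simp [nonzeroDigitCount, Nat.digits_of_lt x n hn.ne' hnx, hn.ne']

lemma nonzeroDigitCount_add_pow_mul {x a b N : ℕ} (hx : 1 < x) (ha : a < x ^ N) (hb : 0 < b) :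
    nonzeroDigitCount x (a + x ^ N * b) = nonzeroDigitCount x a + nonzeroDigitCount x b := by
  obtain ⟨l, rfl⟩ := Nat.exists_eq_add_of_le ((Nat.digits_length_le_iff hx a).2 ha)
  simp [nonzeroDigitCount, ← Nat.digits_append_zeroes_append_digits (k := l) hx hb]

/-- A number `m` such that adding a far away digit one in base `x` behaves generically:
`2 * m` has `q` non-zero digits, and `m ^ 2` has `q * (q + 1) / 2 + 1` of them and is not divisible
by `x`. -/
def IsTriangularRoot (x q m : ℕ) : Prop :=
  nonzeroDigitCount x (2 * m) = q ∧ 2 * nonzeroDigitCount x (m ^ 2) = q * (q + 1) + 2 ∧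
    ¬ x ∣ m ^ 2

lemma isTriangularRoot_sqrt_add_one {x : ℕ} (hx : 6 ≤ x) :
    IsTriangularRoot x 1 (Nat.sqrt x + 1) := by
  have h₁ := Nat.sqrt_le' x
  have h₂ := Nat.lt_succ_sqrt' x
  set s := Nat.sqrt x
  have hs : 2 ≤ s := by
    by_contra! h
    interval_cases s <;> simp at h₂ <;> omega
  have hle : 2 * s + 2 ≤ x := by
    rcases hs.eq_or_lt with h | h
    · omega
    · nlinarith
  obtain ⟨d, hd⟩ := Nat.exists_eq_add_of_lt h₂
  rw [Nat.succ_eq_add_one] at hd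
  have hdx : d + 1 < x := by nlinarith
  refine ⟨?_, ?_, ?_⟩
  · rcases (show 2 * (s + 1) ≤ x by omega).eq_or_lt with h | h
    · rw [h]
      have := nonzeroDigitCount_add_pow_mul (x := x) (a := 0) (b := 1) (N := 1)
        (by omega) (by simp; omega) one_pos
      simp only [pow_one, mul_one, zero_add] at this
      rw [this, nonzeroDigitCount_of_lt one_pos (by omega)]
      simp [nonzeroDigitCount]
    · exact nonzeroDigitCount_of_lt (by omega) h
  · have := nonzeroDigitCount_add_pow_mul (x := x) (a := d + 1) (b := 1) (N := 1)
      (by omega) (by simpa using hdx) one_pos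
    rw [nonzeroDigitCount_of_lt (by omega) hdx, nonzeroDigitCount_of_lt one_pos (by omega)] at this
    rw [hd, show x + d + 1 = d + 1 + x ^ 1 * 1 by ring, this]
  · rw [hd, add_assoc, Nat.dvd_add_right dvd_rfl]
    exact Nat.not_dvd_of_pos_of_lt (by omega) hdx

lemma IsTriangularRoot.exists_gt {x q m : ℕ} (hx : 6 ≤ x) (h : IsTriangularRoot x q m) (B : ℕ) :
    ∃ n, B < n ∧ IsTriangularRoot x (q + 1) n := by
  obtain ⟨h₁, h₂, h₃⟩ := h
  have hm : 0 < m := Nat.pos_of_ne_zero (by rintro rfl; simp at h₃)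
  set N := B + 2 * m + m ^ 2 + 1
  have hN : N < x ^ N := Nat.lt_pow_self (by omega)
  have hsq : (m + x ^ N) ^ 2 = m ^ 2 + x ^ N * (2 * m + x ^ N * 1) := by ring
  have hone : nonzeroDigitCount x 1 = 1 := nonzeroDigitCount_of_lt one_pos (by omega)
  have htwo : nonzeroDigitCount x 2 = 1 := nonzeroDigitCount_of_lt two_pos (by omega)
  refine ⟨m + x ^ N, by omega, ?_, ?_, ?_⟩
  · rw [show 2 * (m + x ^ N) = 2 * m + x ^ N * 2 by ring,
      nonzeroDigitCount_add_pow_mul (by omega) (by omega) two_pos, h₁, htwo]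
  · rw [hsq, nonzeroDigitCount_add_pow_mul (by omega) (by omega) (by omega),
      nonzeroDigitCount_add_pow_mul (by omega) (by omega) one_pos, h₁, hone]
    linarith
  · rw [hsq, Nat.dvd_add_left ((dvd_pow_self x (by omega)).mul_right _)]
    exact h₃

lemma exists_isTriangularRoot {x : ℕ} (hx : 6 ≤ x) (q : ℕ) :
    ∃ m, IsTriangularRoot x (q + 1) m := by
  induction q with
  | zero => exact ⟨_, isTriangularRoot_sqrt_add_one hx⟩
  | succ q ih =>
    obtain ⟨m, hm⟩ := ih
    obtain ⟨n, -, hn⟩ := hm.exists_gt hx 0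
    exact ⟨n, hn⟩

theorem infinitely_many_squares_base_x_ge_six_triangular_form
    (x k : ℕ) (hx : 6 ≤ x) (hk : 4 ≤ k)
    (hform : ∃ p : ℕ, 0 < p ∧ k = p * (p - 1) / 2 + 1) :
    {n : ℕ | ¬ x ∣ n ∧ (∃ m : ℕ, n = m ^ 2) ∧
      ((Nat.digits x n).filter (· ≠ 0)).length = k}.Infinite := by
  obtain ⟨p, -, rfl⟩ := hform
  have hp : 3 ≤ p := by
    by_contra! h
    interval_cases p <;> omega
  obtain ⟨q, rfl⟩ := Nat.exists_eq_add_of_le' hp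
  obtain ⟨m, hm⟩ := exists_isTriangularRoot hx q
  refine Set.infinite_of_forall_exists_gt fun B => ?_
  obtain ⟨n, hBn, -, hcount, hdvd⟩ := hm.exists_gt hx B
  refine ⟨n ^ 2, ⟨hdvd, ⟨n, rfl⟩, ?_⟩, by nlinarith⟩
  change nonzeroDigitCount x (n ^ 2) = _
  have : (q + 3) * (q + 3 - 1) = (q + 1 + 1) * (q + 1 + 1 + 1) := by
    rw [show q + 3 - 1 = q + 2 by omega]; ring
  omega
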